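/- Let θ₁, θ₂ be real numbers such that 1, θ₁, θ₂ are linearly independent over ℤ, let L(x) = x₀ + x₁θ₁ + x₂θ₂, let P and F be linear forms on ℝ³ such that L, P, F are linearly independent, and let (x_ν) be the sequence of minimal points of L with X_ν = |x_ν|, L_ν = L(x_ν), P_ν = P(x_ν). Let α > 2, let r > 0 satisfy α(α−1) < β₀ and r < α² − α + 1, suppose L_j ≤ X_{j+1}^{−α} for all indices j, and let c₀ > 0. Then there exist a constant c > 0 and an index N such that whenever N ≤ ν < k satisfy: L_ν ≥ c₀·X_ν^{−β₀}; the triples x_{ν−1}, x_ν, x_{ν+1} and x_{k−1}, x_k, x_{k+1} are each linearly independent; every x_j with ν ≤ j ≤ k lies in the two-dimensional lattice ℤ³ ∩ span(x_ν, x_{ν+1}); and |P_ν| ≤ L_ν·X_ν^r, |P_{k−1}| ≤ L_{k−1}·X_{k−1}^r, |P_k| ≤ L_k·X_k^r; then L_k ≥ c·X_k^{−β'} where β' = r − α − 1 + β₀/(α − 1), and moreover β' < β₀. -/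

import Mathlib

/-- Euclidean norm of an integer vector in `ℤ³`. -/
noncomputable def enormZ (v : Fin 3 → ℤ) : ℝ :=
  Real.sqrt ((v 0 : ℝ) ^ 2 + (v 1 : ℝ) ^ 2 + (v 2 : ℝ) ^ 2)

/-- The real vector associated to an integer vector. -/
def toR (v : Fin 3 → ℤ) : Fin 3 → ℝ := fun i => (v i : ℝ)

/-- The rational vector associated to an integer vector. -/
def toQ (v : Fin 3 → ℤ) : Fin 3 → ℚ := fun i => (v i : ℚ)

/-- The linear form `L(x) = x₀ + x₁ θ₁ + x₂ θ₂` on `ℝ³`. -/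
noncomputable def Lform (θ₁ θ₂ : ℝ) : (Fin 3 → ℝ) →ₗ[ℝ] ℝ :=
  LinearMap.proj 0 + θ₁ • LinearMap.proj 1 + θ₂ • LinearMap.proj 2

/-- The determinant of three vectors of `ℝ³`, expanded along the first one. -/
def tripleDet (u v w : Fin 3 → ℝ) : ℝ :=
  u 0 * (v 1 * w 2 - v 2 * w 1) - u 1 * (v 0 * w 2 - v 2 * w 0) + u 2 * (v 0 * w 1 - v 1 * w 0)

theorem tripleDet_ne_zero_of_linearIndependent {u v w : Fin 3 → ℝ}
    (h : LinearIndependent ℝ ![u, v, w]) : tripleDet u v w ≠ 0 := by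
  have h1 : IsUnit (Matrix.of ![u, v, w]) := Matrix.linearIndependent_rows_iff_isUnit.1 h
  have h2 := (Matrix.isUnit_iff_isUnit_det _).1 h1
  have h3 := h2.ne_zero
  rw [Matrix.det_fin_three] at h3
  simp at h3
  unfold tripleDet
  contrapose! h3
  linarith

theorem one_le_abs_tripleDet {u v w : Fin 3 → ℤ} (h : tripleDet (toR u) (toR v) (toR w) ≠ 0) :
    1 ≤ |tripleDet (toR u) (toR v) (toR w)| := by
  have key : tripleDet (toR u) (toR v) (toR w) =
      ((u 0 * (v 1 * w 2 - v 2 * w 1) - u 1 * (v 0 * w 2 - v 2 * w 0) +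
        u 2 * (v 0 * w 1 - v 1 * w 0) : ℤ) : ℝ) := by
    simp [tripleDet, toR]
  rw [key] at h ⊢
  exact_mod_cast Int.one_le_abs (by exact_mod_cast h)

theorem tripleDet_toR_ne_zero {u v w : Fin 3 → ℤ}
    (h : LinearIndependent ℚ ![toQ u, toQ v, toQ w]) :
    tripleDet (toR u) (toR v) (toR w) ≠ 0 := by
  have h1 : IsUnit (Matrix.of ![toQ u, toQ v, toQ w]) :=
    Matrix.linearIndependent_rows_iff_isUnit.1 h
  have h3 := ((Matrix.isUnit_iff_isUnit_det _).1 h1).ne_zero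
  rw [Matrix.det_fin_three] at h3
  simp [toQ] at h3
  simp only [tripleDet, toR]
  contrapose! h3
  have : (((u 0 * (v 1 * w 2 - v 2 * w 1) - u 1 * (v 0 * w 2 - v 2 * w 0) +
      u 2 * (v 0 * w 1 - v 1 * w 0) : ℤ) : ℝ)) = 0 := by
    push_cast; exact h3
  have h4 := Int.cast_eq_zero.1 this
  have h5 : (((u 0 * (v 1 * w 2 - v 2 * w 1) - u 1 * (v 0 * w 2 - v 2 * w 0) +
      u 2 * (v 0 * w 1 - v 1 * w 0) : ℤ) : ℚ)) = 0 := by rw [h4]; simp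
  push_cast at h5
  linarith

/-- The coordinates of a linear form on `ℝ³`. -/
def formCoeff (φ : (Fin 3 → ℝ) →ₗ[ℝ] ℝ) : Fin 3 → ℝ := fun i => φ (Pi.single i 1)

theorem apply_eq_formCoeff (φ : (Fin 3 → ℝ) →ₗ[ℝ] ℝ) (y : Fin 3 → ℝ) :
    φ y = formCoeff φ 0 * y 0 + formCoeff φ 1 * y 1 + formCoeff φ 2 * y 2 := by
  have hy : y = y 0 • Pi.single 0 1 + y 1 • Pi.single 1 1 + y 2 • Pi.single 2 1 := by
    ext i
    fin_cases i <;> simp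
  conv_lhs => rw [hy]
  simp only [map_add, map_smul, smul_eq_mul, formCoeff]
  ring

theorem tripleDet_formCoeff_ne_zero {φ ψ χ : (Fin 3 → ℝ) →ₗ[ℝ] ℝ}
    (h : LinearIndependent ℝ ![φ, ψ, χ]) :
    tripleDet (formCoeff φ) (formCoeff ψ) (formCoeff χ) ≠ 0 := by
  apply tripleDet_ne_zero_of_linearIndependent
  let T : ((Fin 3 → ℝ) →ₗ[ℝ] ℝ) →ₗ[ℝ] (Fin 3 → ℝ) :=
    { toFun := formCoeff
      map_add' := fun _ _ => rfl
      map_smul' := fun _ _ => rfl }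
  have hT : LinearMap.ker T = ⊥ := by
    rw [LinearMap.ker_eq_bot]
    intro a b hab
    have hab' : formCoeff a = formCoeff b := hab
    ext1 y
    ext
    exact congrFun hab' y
  rw [show ![formCoeff φ, formCoeff ψ, formCoeff χ] = T ∘ ![φ, ψ, χ] by
    ext i : 1
    fin_cases i <;> rfl]
  exact h.map' T hT

/-- Multiplicativity of the determinant, for three linear forms evaluated at three vectors. -/
theorem tripleDet_mul (φ ψ χ : (Fin 3 → ℝ) →ₗ[ℝ] ℝ) (u v w : Fin 3 → ℝ) :
    φ u * (ψ v * χ w - ψ w * χ v) - ψ u * (φ v * χ w - φ w * χ v) +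
      χ u * (φ v * ψ w - φ w * ψ v) =
    tripleDet (formCoeff φ) (formCoeff ψ) (formCoeff χ) * tripleDet u v w := by
  simp only [apply_eq_formCoeff φ, apply_eq_formCoeff ψ, apply_eq_formCoeff χ, tripleDet]
  ring

theorem abs_coord_le_enormZ (v : Fin 3 → ℤ) (i : Fin 3) : |(v i : ℝ)| ≤ enormZ v := by
  rw [← Real.sqrt_sq_eq_abs]
  apply Real.sqrt_le_sqrt
  fin_cases i <;> simp <;> nlinarith [sq_nonneg (v 0 : ℝ), sq_nonneg (v 1 : ℝ), sq_nonneg (v 2 : ℝ)]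

theorem enormZ_nonneg (v : Fin 3 → ℤ) : 0 ≤ enormZ v := Real.sqrt_nonneg _

theorem exists_abs_apply_le (φ : (Fin 3 → ℝ) →ₗ[ℝ] ℝ) :
    ∃ C : ℝ, 0 < C ∧ ∀ v : Fin 3 → ℤ, |φ (toR v)| ≤ C * enormZ v := by
  refine ⟨|formCoeff φ 0| + |formCoeff φ 1| + |formCoeff φ 2| + 1, by positivity, fun v => ?_⟩
  rw [apply_eq_formCoeff]
  have hb (i : Fin 3) : |formCoeff φ i * toR v i| ≤ |formCoeff φ i| * enormZ v := by
    rw [abs_mul]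
    exact mul_le_mul_of_nonneg_left (abs_coord_le_enormZ v i) (abs_nonneg _)
  have := abs_add_three (formCoeff φ 0 * toR v 0) (formCoeff φ 1 * toR v 1)
    (formCoeff φ 2 * toR v 2)
  linarith [hb 0, hb 1, hb 2, enormZ_nonneg v]

/-- Hadamard-type bound for the determinant, with one column replaced by the values of `L`. -/
theorem abs_tripleDet_le (θ₁ θ₂ : ℝ) {u v w : Fin 3 → ℤ} {l : ℝ}
    (hu : |Lform θ₁ θ₂ (toR u)| ≤ l) (hv : |Lform θ₁ θ₂ (toR v)| ≤ l)
    (hw : |Lform θ₁ θ₂ (toR w)| ≤ l) (huv : enormZ u ≤ enormZ v) (hvw : enormZ v ≤ enormZ w) :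
    |tripleDet (toR u) (toR v) (toR w)| ≤ 6 * (l * (enormZ v * enormZ w)) := by
  have hmin {a b : Fin 3 → ℤ} (ha : enormZ a ≤ enormZ v) (hb : enormZ b ≤ enormZ w) :
      |(a 1 : ℝ) * b 2 - a 2 * b 1| ≤ 2 * (enormZ v * enormZ w) := by
    have h1 : |(a 1 : ℝ) * b 2| ≤ enormZ v * enormZ w := by
      rw [abs_mul]
      exact mul_le_mul ((abs_coord_le_enormZ a 1).trans ha) ((abs_coord_le_enormZ b 2).trans hb)
        (abs_nonneg _) (enormZ_nonneg _)
    have h2 : |(a 2 : ℝ) * b 1| ≤ enormZ v * enormZ w := by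
      rw [abs_mul]
      exact mul_le_mul ((abs_coord_le_enormZ a 2).trans ha) ((abs_coord_le_enormZ b 1).trans hb)
        (abs_nonneg _) (enormZ_nonneg _)
    linarith [abs_sub ((a 1 : ℝ) * b 2) (a 2 * b 1)]
  have hl : 0 ≤ l := (abs_nonneg _).trans hu
  have hterm {s t : ℝ} (hs : |s| ≤ l) (ht : |t| ≤ 2 * (enormZ v * enormZ w)) :
      |s * t| ≤ 2 * (l * (enormZ v * enormZ w)) := by
    rw [abs_mul]
    have := mul_le_mul hs ht (abs_nonneg _) hl
    linarith
  have e : tripleDet (toR u) (toR v) (toR w) =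
      Lform θ₁ θ₂ (toR u) * ((v 1 : ℝ) * w 2 - v 2 * w 1) +
      -(Lform θ₁ θ₂ (toR v) * ((u 1 : ℝ) * w 2 - u 2 * w 1)) +
      Lform θ₁ θ₂ (toR w) * ((u 1 : ℝ) * v 2 - u 2 * v 1) := by
    simp [tripleDet, Lform, toR]
    ring
  rw [e]
  refine (abs_add_three _ _ _).trans ?_
  rw [abs_neg]
  linarith [hterm hu (hmin le_rfl le_rfl), hterm hv (hmin huv le_rfl), hterm hw (hmin huv hvw)]

/-- Two vectors `v, w` of the plane spanned by `b, c` multiply determinants by a common factor. -/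
theorem exists_tripleDet_eq_mul {b c v w : Fin 3 → ℝ} (hv : v ∈ Submodule.span ℝ {b, c})
    (hw : w ∈ Submodule.span ℝ {b, c}) :
    ∃ t : ℝ, ∀ a, tripleDet a v w = t * tripleDet a b c := by
  obtain ⟨p, q, rfl⟩ := Submodule.mem_span_pair.1 hv
  obtain ⟨p', q', rfl⟩ := Submodule.mem_span_pair.1 hw
  refine ⟨p * q' - q * p', fun a => ?_⟩
  simp [tripleDet]
  ring

theorem sqrt_nat_le_enormZ {x : ℕ → Fin 3 → ℤ} (h : ∀ n, enormZ (x n) < enormZ (x (n + 1)))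
    (n : ℕ) : √(n : ℝ) ≤ enormZ (x n) := by
  suffices H : (n : ℤ) ≤ x n 0 ^ 2 + x n 1 ^ 2 + x n 2 ^ 2 by
    apply Real.sqrt_le_sqrt
    exact_mod_cast H
  induction n with
  | zero => push_cast; positivity
  | succ n ih =>
    have h1 := lt_of_not_ge fun hle => (h n).not_ge (Real.sqrt_le_sqrt hle)
    have h2 : x n 0 ^ 2 + x n 1 ^ 2 + x n 2 ^ 2 <
        x (n + 1) 0 ^ 2 + x (n + 1) 1 ^ 2 + x (n + 1) 2 ^ 2 := by exact_mod_cast h1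
    push_cast
    linarith

theorem exists_forall_mul_rpow_neg_le {s : ℝ} (hs : 0 < s) (A : ℝ) {η : ℝ} (hη : 0 < η) :
    ∃ X₀ : ℝ, ∀ X, X₀ ≤ X → A * X ^ (-s) ≤ η := by
  have h := (tendsto_rpow_neg_atTop hs).const_mul A
  rw [mul_zero] at h
  exact Filter.eventually_atTop.1 (h.eventually_le_const hη)

theorem exponent_lt {α r β : ℝ} (hα : 2 < α) (hβ : α * (α - 1) < β) (hr : r < α ^ 2 - α + 1) :
    r - α - 1 + β / (α - 1) < β := by
  have h1 : 0 < α - 1 := by linarith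
  have h2 : α < β / (α - 1) := by rwa [lt_div_iff₀ h1]
  have h3 : β / (α - 1) * (α - 1) = β := div_mul_cancel₀ _ h1.ne'
  nlinarith

/-- A vector `u` off the plane forces the `P F`-minor `m` to be large. -/
theorem rpow_le_abs_minor {α C δ X Y lu pu fu m a b : ℝ} (hα : 2 < α) (hC : 0 < C)
    (hX : 1 ≤ X) (hXY : X ≤ Y) (hlu0 : 0 < lu) (hlu : lu ≤ X ^ (-α))
    (hpu : |pu| ≤ C * X) (hfu : |fu| ≤ C * X)
    (ha : |a| ≤ 2 * C * Y ^ (1 - α)) (hb : |b| ≤ 2 * C * Y ^ (1 - α))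
    (hδ : δ ≤ |lu * m - pu * a + fu * b|) (hlarge : 4 * C ^ 2 * X ^ (-(α - 2)) ≤ δ / 2) :
    δ / 2 * X ^ α ≤ |m| := by
  have hX0 : 0 < X := by linarith
  have hYX : Y ^ (1 - α) ≤ X ^ (1 - α) :=
    Real.rpow_le_rpow_of_nonpos hX0 hXY (by linarith)
  have hXX : X * X ^ (1 - α) = X ^ (-(α - 2)) := by
    rw [← Real.rpow_one_add' hX0.le (by linarith)]; congr 1; ring
  have hbd {s t : ℝ} (hs : |s| ≤ C * X) (ht : |t| ≤ 2 * C * Y ^ (1 - α)) :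
      |s * t| ≤ 2 * C ^ 2 * X ^ (-(α - 2)) := by
    rw [abs_mul, ← hXX]
    calc |s| * |t| ≤ (C * X) * (2 * C * X ^ (1 - α)) :=
          mul_le_mul hs (ht.trans (by gcongr)) (abs_nonneg _) (by positivity)
      _ = _ := by ring
  have h1 : |lu * m| ≤ X ^ (-α) * |m| := by
    rw [abs_mul, abs_of_pos hlu0]; gcongr
  have h2 : |lu * m - pu * a + fu * b| ≤ |lu * m| + |pu * a| + |fu * b| :=
    (abs_add_le _ _).trans (by linarith [abs_sub (lu * m) (pu * a)])
  have h3 : δ / 2 ≤ X ^ (-α) * |m| := by linarith [hbd hpu ha, hbd hfu hb]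
  rw [Real.rpow_neg hX0.le, inv_mul_eq_div, le_div_iff₀ (by positivity)] at h3
  exact h3

/-- A vector of the plane on which `P` is small bounds the `L P`-minor `b` from below. -/
theorem mul_rpow_le_abs_minor {α r C δ X Y l p f m a b : ℝ} (hα : 2 < α) (hC : 0 < C)
    (hX : 1 ≤ X) (hXY : X ^ (α - 1) / 6 ≤ Y) (hl : 0 < l)
    (hp : |p| ≤ l * X ^ r) (hf : |f| ≤ C * X) (ha : |a| ≤ 2 * C * Y ^ (1 - α))
    (hm : δ / 2 * X ^ α ≤ |m|) (hzero : l * m - p * a + f * b = 0)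
    (hlarge : 2 * C * (1 / 6) ^ (1 - α) * X ^ (-(α ^ 2 - α + 1 - r)) ≤ δ / 4) :
    δ / (4 * C) * l * X ^ (α - 1) ≤ |b| := by
  have hX0 : 0 < X := by linarith
  have hY : Y ^ (1 - α) ≤ (1 / 6) ^ (1 - α) * X ^ ((α - 1) * (1 - α)) := by
    rw [Real.rpow_mul hX0.le, ← Real.mul_rpow (by positivity) (by positivity)]
    refine Real.rpow_le_rpow_of_nonpos (by positivity) ?_ (by linarith)
    linarith
  have h1 : |p * a| ≤ l * (δ / 4 * X ^ α) := by
    rw [abs_mul]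
    calc |p| * |a| ≤ (l * X ^ r) * (2 * C * ((1 / 6) ^ (1 - α) * X ^ ((α - 1) * (1 - α)))) :=
          mul_le_mul hp (ha.trans (by gcongr)) (abs_nonneg _) (by positivity)
      _ = l * ((2 * C * (1 / 6) ^ (1 - α)) * (X ^ r * X ^ ((α - 1) * (1 - α)))) := by ring
      _ = l * ((2 * C * (1 / 6) ^ (1 - α)) * (X ^ (-(α ^ 2 - α + 1 - r)) * X ^ α)) := by
          rw [← Real.rpow_add hX0, ← Real.rpow_add hX0]; ring_nf
      _ = l * ((2 * C * (1 / 6) ^ (1 - α) * X ^ (-(α ^ 2 - α + 1 - r))) * X ^ α) := by ring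
      _ ≤ _ := by gcongr
  have h2 : |l * m| ≤ |p * a| + |f * b| := by
    rw [show l * m = p * a - f * b by linarith]; exact abs_sub _ _
  rw [abs_mul l, abs_of_pos hl] at h2
  have h3 : |f * b| ≤ C * X * |b| := by rw [abs_mul]; gcongr
  have h4 := mul_le_mul_of_nonneg_left hm hl.le
  have h5 : δ / 4 * l * X ^ α ≤ C * X * |b| := by nlinarith
  rw [show α = (α - 1) + 1 by ring, Real.rpow_add_one hX0.ne'] at h5
  have h6 : δ / 4 * l * X ^ (α - 1) ≤ C * |b| := by
    refine le_of_mul_le_mul_right ?_ hX0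
    linarith
  rw [show δ / (4 * C) * l * X ^ (α - 1) = δ / 4 * l * X ^ (α - 1) / C by field_simp,
    div_le_iff₀ hC]
  linarith

/-- Comparison of lower and upper bounds for the `L P`-minor `b`. -/
theorem rpow_le_of_minor_bounds {α r β c₀ κ X Z l lk b : ℝ} (hα : 2 < α) (hκ : 0 < κ)
    (hc₀ : 0 < c₀) (hβ : α * (α - 1) < β) (hX : 1 ≤ X) (hXZ : X ^ (α - 1) / 6 ≤ Z)
    (hl : c₀ * X ^ (-β) ≤ l) (hlow : κ * l * X ^ (α - 1) ≤ |b|)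
    (hup : |b| ≤ 2 * lk * Z ^ (r - α)) :
    κ * c₀ / 2 * 6 ^ (1 - β / (α - 1)) * Z ^ (-(r - α - 1 + β / (α - 1))) ≤ lk := by
  have hX0 : 0 < X := by linarith
  have hα1 : 0 < α - 1 := by linarith
  have hZ0 : 0 < Z := lt_of_lt_of_le (by positivity) hXZ
  have h1 : (6 * Z) ^ (1 - β / (α - 1)) ≤ X ^ (α - 1 - β) := by
    have e : α - 1 - β = (α - 1) * (1 - β / (α - 1)) := by field_simp
    rw [e, Real.rpow_mul hX0.le]
    refine Real.rpow_le_rpow_of_nonpos (by positivity) (by linarith) ?_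
    have : 1 ≤ β / (α - 1) := by rw [le_div_iff₀ hα1]; nlinarith
    linarith
  have h2 : κ * c₀ * X ^ (α - 1 - β) ≤ κ * l * X ^ (α - 1) := by
    rw [show α - 1 - β = -β + (α - 1) by ring, Real.rpow_add hX0]
    calc κ * c₀ * (X ^ (-β) * X ^ (α - 1)) = κ * (c₀ * X ^ (-β)) * X ^ (α - 1) := by ring
      _ ≤ _ := by gcongr
  rw [Real.mul_rpow (by norm_num) hZ0.le] at h1
  have h3 : κ * c₀ * (6 ^ (1 - β / (α - 1)) * Z ^ (1 - β / (α - 1))) ≤ 2 * lk * Z ^ (r - α) :=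
    (mul_le_mul_of_nonneg_left h1 (by positivity)).trans (h2.trans (hlow.trans hup))
  rw [show -(r - α - 1 + β / (α - 1)) = (1 - β / (α - 1)) - (r - α) by ring, Real.rpow_sub hZ0,
    ← mul_div_assoc, div_le_iff₀ (by positivity)]
  linarith

/-- The minor of `L` and `φ` at two vectors, when `L` decreases and the norm increases. -/
theorem abs_minor_le {l l' p p' A B : ℝ} (hl' : 0 < l') (hll : l' ≤ l) (hA : A ≤ B)
    (hp : |p| ≤ A) (hp' : |p'| ≤ B) : |l * p' - l' * p| ≤ 2 * (l * B) := by
  have h1 : |l * p'| ≤ l * B := by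
    rw [abs_mul, abs_of_pos (hl'.trans_le hll)]
    exact mul_le_mul_of_nonneg_left hp' (by linarith)
  have h2 : |l' * p| ≤ l * B := by
    rw [abs_mul, abs_of_pos hl']
    exact mul_le_mul hll (hp.trans hA) (abs_nonneg _) (by linarith)
  linarith [abs_sub (l * p') (l' * p)]

/-- The main estimate (second part of Lemma 5): under the stated conditions there are `c > 0`
and an index `N` such that whenever `N ≤ ν < k` satisfy `L_ν ≥ c₀·X_ν^{−β₀}`, the triples
`x_{ν−1}, x_ν, x_{ν+1}` and `x_{k−1}, x_k, x_{k+1}` are each linearly independent, all `x_j`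
with `ν ≤ j ≤ k` lie in `ℤ³ ∩ span(x_ν, x_{ν+1})`, and `|P_ν| ≤ L_ν·X_ν^r`,
`|P_{k−1}| ≤ L_{k−1}·X_{k−1}^r`, `|P_k| ≤ L_k·X_k^r`, then `L_k ≥ c·X_k^{−β'}` with
`β' = r − α − 1 + β₀/(α−1)`; moreover `β' < β₀`. -/
theorem main_estimate_improved_decay (θ₁ θ₂ : ℝ)
    (hind : ∀ a b c : ℤ, (a : ℝ) + (b : ℝ) * θ₁ + (c : ℝ) * θ₂ = 0 → a = 0 ∧ b = 0 ∧ c = 0)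
    (P F : (Fin 3 → ℝ) →ₗ[ℝ] ℝ)
    (hLPF : LinearIndependent ℝ ![Lform θ₁ θ₂, P, F])
    -- `x` is the sequence of minimal points (best approximations) of `L`:
    (x : ℕ → Fin 3 → ℤ)
    (hx0 : ∀ ν, x ν ≠ 0)
    (hLpos : ∀ ν, 0 < Lform θ₁ θ₂ (toR (x ν)))
    (hXlt : ∀ ν, enormZ (x ν) < enormZ (x (ν + 1)))
    (hLlt : ∀ ν, Lform θ₁ θ₂ (toR (x (ν + 1))) < Lform θ₁ θ₂ (toR (x ν)))
    (hbest : ∀ ν, ∀ y : Fin 3 → ℤ, y ≠ 0 → enormZ y < enormZ (x (ν + 1)) →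
      Lform θ₁ θ₂ (toR (x ν)) ≤ |Lform θ₁ θ₂ (toR y)|)
    (α r β₀ c₀ : ℝ) (hα : 2 < α) (hr0 : 0 < r) (hβ₀ : α * (α - 1) < β₀)
    (hr : r < α ^ 2 - α + 1) (hc₀ : 0 < c₀)
    (hsii : ∀ j, Lform θ₁ θ₂ (toR (x j)) ≤ enormZ (x (j + 1)) ^ (-α)) :
    (r - α - 1 + β₀ / (α - 1) < β₀) ∧
    ∃ c > (0 : ℝ), ∃ N : ℕ, ∀ ν k, N ≤ ν → ν < k →
      c₀ * enormZ (x ν) ^ (-β₀) ≤ Lform θ₁ θ₂ (toR (x ν)) →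
      LinearIndependent ℚ ![toQ (x (ν - 1)), toQ (x ν), toQ (x (ν + 1))] →
      LinearIndependent ℚ ![toQ (x (k - 1)), toQ (x k), toQ (x (k + 1))] →
      (∀ j, ν ≤ j → j ≤ k →
        toR (x j) ∈ Submodule.span ℝ {toR (x ν), toR (x (ν + 1))}) →
      |P (toR (x ν))| ≤ Lform θ₁ θ₂ (toR (x ν)) * enormZ (x ν) ^ r →
      |P (toR (x (k - 1)))| ≤ Lform θ₁ θ₂ (toR (x (k - 1))) * enormZ (x (k - 1)) ^ r →
      |P (toR (x k))| ≤ Lform θ₁ θ₂ (toR (x k)) * enormZ (x k) ^ r →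
      c * enormZ (x k) ^ (-(r - α - 1 + β₀ / (α - 1))) ≤ Lform θ₁ θ₂ (toR (x k)) := by
  refine ⟨exponent_lt hα hβ₀ hr, ?_⟩
  obtain ⟨C₁, hC₁, hP⟩ := exists_abs_apply_le P
  obtain ⟨C₂, hC₂, hF⟩ := exists_abs_apply_le F
  set L := Lform θ₁ θ₂
  set Δ := tripleDet (formCoeff L) (formCoeff P) (formCoeff F)
  have hδ : 0 < |Δ| := abs_pos.2 (tripleDet_formCoeff_ne_zero hLPF)
  set C := max C₁ C₂
  have hC : 0 < C := hC₁.trans_le (le_max_left _ _)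
  replace hP (v) : |P (toR v)| ≤ C * enormZ v :=
    (hP v).trans (mul_le_mul_of_nonneg_right (le_max_left _ _) (enormZ_nonneg v))
  replace hF (v) : |F (toR v)| ≤ C * enormZ v :=
    (hF v).trans (mul_le_mul_of_nonneg_right (le_max_right _ _) (enormZ_nonneg v))
  obtain ⟨X₁, hX₁⟩ := exists_forall_mul_rpow_neg_le (s := α - 2) (by linarith) (4 * C ^ 2)
    (half_pos hδ)
  obtain ⟨X₂, hX₂⟩ := exists_forall_mul_rpow_neg_le (s := α ^ 2 - α + 1 - r) (by linarith)
    (2 * C * (1 / 6) ^ (1 - α)) (by positivity : 0 < |Δ| / 4)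
  have hXmono : StrictMono fun n => enormZ (x n) := strictMono_nat_of_lt_succ hXlt
  have hLanti : StrictAnti fun n => L (toR (x n)) := strictAnti_nat_of_succ_lt hLlt
  have hXtop : Filter.Tendsto (fun n => enormZ (x n)) Filter.atTop Filter.atTop :=
    Filter.tendsto_atTop_mono (sqrt_nat_le_enormZ hXlt)
      (Real.tendsto_sqrt_atTop.comp tendsto_natCast_atTop_atTop)
  obtain ⟨N, hN⟩ := Filter.eventually_atTop.1
    (hXtop.eventually_ge_atTop (max 1 (max X₁ X₂)))
  refine ⟨|Δ| / (4 * C) * c₀ / 2 * 6 ^ (1 - β₀ / (α - 1)), by positivity, N + 1, ?_⟩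
  intro ν k hNν hνk hlν hdetν hdetk hspan hPν hPk' hPk
  obtain ⟨i, rfl⟩ : ∃ i, ν = i + 1 := ⟨ν - 1, by omega⟩
  obtain ⟨j, rfl⟩ : ∃ j, k = j + 1 := ⟨k - 1, by omega⟩
  rw [Nat.add_sub_cancel] at hdetν hdetk hPk'
  have hXge := hN (i + 1) (by omega)
  have hX1 : 1 ≤ enormZ (x (i + 1)) := (le_max_left _ _).trans hXge
  have hXX₁ : X₁ ≤ enormZ (x (i + 1)) :=
    (le_max_left _ _).trans ((le_max_right _ _).trans hXge)
  have hXX₂ : X₂ ≤ enormZ (x (i + 1)) :=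
    (le_max_right _ _).trans ((le_max_right _ _).trans hXge)
  have hX0 : 0 < enormZ (x (i + 1)) := by linarith
  have hXY := hXmono.monotone (show i + 1 ≤ i + 1 + 1 by omega)
  have hYZ := hXmono.monotone (show i + 1 + 1 ≤ j + 1 by omega)
  have hWZ := hXmono.monotone (show j ≤ j + 1 by omega)
  have hUX := hXmono.monotone (show i ≤ i + 1 by omega)
  have hLL := hLanti.antitone (show j ≤ j + 1 by omega)
  have hZ0 : 0 < enormZ (x (j + 1)) := by linarith
  have hdν := tripleDet_toR_ne_zero hdetν
  have hdk := tripleDet_toR_ne_zero hdetk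
  obtain ⟨t, ht⟩ := exists_tripleDet_eq_mul (hspan j (by omega) (by omega))
    (hspan (j + 1) (by omega) le_rfl)
  have hcyc (a b c : Fin 3 → ℝ) : tripleDet a b c = tripleDet c a b := by
    unfold tripleDet; ring
  have ht0 : t ≠ 0 := by
    rintro rfl
    rw [hcyc, ht, zero_mul] at hdk
    exact hdk rfl
  have hoff : 1 ≤ |tripleDet (toR (x i)) (toR (x j)) (toR (x (j + 1)))| :=
    one_le_abs_tripleDet (by rw [ht]; exact mul_ne_zero ht0 hdν)
  have hon : tripleDet (toR (x (i + 1))) (toR (x j)) (toR (x (j + 1))) = 0 := by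
    rw [ht]; simp only [tripleDet]; ring
  have hgap : enormZ (x (i + 1)) ^ (α - 1) / 6 ≤ enormZ (x (i + 1 + 1)) := by
    have hle (n) (hn : i ≤ n) : |L (toR (x n))| ≤ enormZ (x (i + 1)) ^ (-α) := by
      rw [abs_of_pos (hLpos n)]
      exact (hLanti.antitone hn).trans (hsii i)
    have h1 := (one_le_abs_tripleDet hdν).trans
      (abs_tripleDet_le θ₁ θ₂ (hle i le_rfl) (hle (i + 1) (by omega))
        (hle (i + 1 + 1) (by omega)) hUX hXY)
    rw [← mul_assoc (_ ^ _), ← Real.rpow_add_one hX0.ne', show -α + 1 = -(α - 1) by ring,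
      Real.rpow_neg hX0.le, inv_mul_eq_div, ← mul_div_assoc, le_div_iff₀ (by positivity)] at h1
    linarith
  have hminor {φ : (Fin 3 → ℝ) →ₗ[ℝ] ℝ} (hφ : ∀ v, |φ (toR v)| ≤ C * enormZ v) :
      |L (toR (x j)) * φ (toR (x (j + 1))) - L (toR (x (j + 1))) * φ (toR (x j))| ≤
        2 * C * enormZ (x (i + 1 + 1)) ^ (1 - α) := by
    refine (abs_minor_le (hLpos _) hLL (mul_le_mul_of_nonneg_left hWZ hC.le) (hφ _)
      (hφ _)).trans ?_
    calc 2 * (L (toR (x j)) * (C * enormZ (x (j + 1))))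
        ≤ 2 * (enormZ (x (j + 1)) ^ (-α) * (C * enormZ (x (j + 1)))) := by
          gcongr; exact hsii j
      _ = 2 * C * enormZ (x (j + 1)) ^ (1 - α) := by
          rw [show 1 - α = -α + 1 by ring, Real.rpow_add_one hZ0.ne']; ring
      _ ≤ _ := by
          gcongr ?_ * ?_
          exact Real.rpow_le_rpow_of_nonpos (by linarith) hYZ (by linarith)
  have hbig := rpow_le_abs_minor (δ := |Δ|) hα hC hX1 hXY (hLpos i) (hsii i)
    ((hP (x i)).trans (mul_le_mul_of_nonneg_left hUX hC.le))
    ((hF (x i)).trans (mul_le_mul_of_nonneg_left hUX hC.le)) (hminor hF) (hminor hP)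
    (by rw [tripleDet_mul, abs_mul]; exact le_mul_of_one_le_right hδ.le hoff) (hX₁ _ hXX₁)
  have hlow := mul_rpow_le_abs_minor hα hC hX1 hgap (hLpos (i + 1)) hPν (hF _) (hminor hF) hbig
    (by rw [tripleDet_mul, hon, mul_zero]) (hX₂ _ hXX₂)
  refine rpow_le_of_minor_bounds hα (by positivity) hc₀ hβ₀ hX1 (hgap.trans hYZ) hlν hlow ?_
  have hrpow := Real.rpow_le_rpow (enormZ_nonneg _) hWZ hr0.le
  have hlj := hLpos j
  have hlj' := hLpos (j + 1)
  have hterm : L (toR (x j)) * L (toR (x (j + 1))) * enormZ (x (j + 1)) ^ r ≤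
      L (toR (x (j + 1))) * enormZ (x (j + 1)) ^ (r - α) := by
    rw [show r - α = -α + r by ring, Real.rpow_add hZ0]
    calc _ = L (toR (x (j + 1))) * (L (toR (x j)) * enormZ (x (j + 1)) ^ r) := by ring
      _ ≤ _ := by gcongr; exact hsii j
  have h1 : |L (toR (x j)) * P (toR (x (j + 1)))| ≤
      L (toR (x j)) * L (toR (x (j + 1))) * enormZ (x (j + 1)) ^ r := by
    rw [abs_mul, abs_of_pos hlj, mul_assoc]
    gcongr
  have h2 : |L (toR (x (j + 1))) * P (toR (x j))| ≤
      L (toR (x j)) * L (toR (x (j + 1))) * enormZ (x (j + 1)) ^ r := by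
    rw [abs_mul, abs_of_pos hlj', mul_comm (L (toR (x j))), mul_assoc]
    gcongr
    exact hPk'.trans (by gcongr)
  linarith [abs_sub (L (toR (x j)) * P (toR (x (j + 1)))) (L (toR (x (j + 1))) * P (toR (x j)))]
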